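/- Let K = F_3(x)[y]/(y^2 + 2x^6+x^5+2x^4+x^3+2x^2+x+2) be the quadratic function field over F_3(x) obtained by adjoining a root y of the irreducible polynomial Y^2 + (2x^6+x^5+2x^4+x^3+2x^2+x+2), and let L = K[T_1]/(T_1^3 + 2T_1 + (x^3+2x^2+x+1+1/x)y + x^6+2x^2+2x+1/x) be the field obtained from K by adjoining a root T_1 of that irreducible cubic. Then the polynomial T_2^3 + 2T_2 + (x^4+2x^3+x^2+2)y/x + (x^7+2x^4+2x^3+2x+2)/x, in the variable T_2 with coefficients in L, is irreducible over L. (Consequently the compositum L(T_2) has degree 9 over K; it is the record curve of genus 22 with 33 rational points over F_3.) -/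

import Mathlib

open Polynomial

/-- `x` denotes the generator `X` of the rational function field `F₃(x)`. -/
noncomputable def x : RatFunc (ZMod 3) := RatFunc.X

/-- The defining polynomial `Y² + (2x⁶+x⁵+2x⁴+x³+2x²+x+2)` of the genus-2 base field
over `F₃`. -/
noncomputable def p : Polynomial (RatFunc (ZMod 3)) :=
  X ^ 2 + C (2 * x ^ 6 + x ^ 5 + 2 * x ^ 4 + x ^ 3 + 2 * x ^ 2 + x + 2)

/-- The image of `x` in `K = F₃(x)[y]/(p)`. -/
noncomputable def xK : AdjoinRoot p := AdjoinRoot.of p x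

/-- The adjoined root `y` in `K = F₃(x)[y]/(p)`. -/
noncomputable def y : AdjoinRoot p := AdjoinRoot.root p

/-- The cubic `T₁³ + 2T₁ + (x³+2x²+x+1+1/x)y + x⁶+2x²+2x+1/x` over `K`, defining
`L = K[T₁]/(q)`. -/
noncomputable def q : Polynomial (AdjoinRoot p) :=
  X ^ 3 + C (2 : AdjoinRoot p) * X +
    C ((xK ^ 3 + 2 * xK ^ 2 + xK + 1 + AdjoinRoot.of p x⁻¹) * y +
      xK ^ 6 + 2 * xK ^ 2 + 2 * xK + AdjoinRoot.of p x⁻¹)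

/-- Cubing is additive in characteristic `3`. -/
theorem add_cube {R : Type*} [CommRing R] (h3 : (3 : R) = 0) (a b : R) :
    (a + b) ^ 3 = a ^ 3 + b ^ 3 := by
  linear_combination (a ^ 2 * b + a * b ^ 2) * h3

theorem eq_zero_or_one_or_neg_one_of_cube_eq {F : Type*} [Field F] {v : F} (hv : v ^ 3 = v) :
    v = 0 ∨ v = 1 ∨ v = -1 := by
  have h : v * ((v - 1) * (v + 1)) = 0 := by linear_combination hv
  rcases mul_eq_zero.1 h with h | h
  · exact .inl h
  · rcases mul_eq_zero.1 h with h | h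
    · exact .inr (.inl (sub_eq_zero.1 h))
    · exact .inr (.inr (eq_neg_of_add_eq_zero_left h))

theorem AdjoinRoot.exists_mk_eq_of_degree_lt {R : Type*} [CommRing R] {f : R[X]} (hf : f.Monic)
    [Nontrivial R] (t : AdjoinRoot f) :
    ∃ g : R[X], g.degree < f.degree ∧ AdjoinRoot.mk f g = t := by
  obtain ⟨g, rfl⟩ := AdjoinRoot.mk_surjective t
  exact ⟨g %ₘ f, degree_modByMonic_lt g hf, AdjoinRoot.mk_eq_mk.2
    (by rw [modByMonic_eq_sub_mul_div]; exact ⟨-(g /ₘ f), by ring⟩)⟩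

theorem AdjoinRoot.eq_zero_of_mk_eq_zero {R : Type*} [CommRing R] {f g : R[X]} (hf : f.Monic)
    (hg : g.degree < f.degree) (h : AdjoinRoot.mk f g = 0) : g = 0 := by
  by_contra h0
  exact hf.not_dvd_of_degree_lt h0 hg (AdjoinRoot.mk_eq_zero.1 h)

theorem degree_cube_add_linear {F : Type*} [Field F] (c a : F) :
    (X ^ 3 + C c * X + C a : F[X]).degree = 3 := by
  compute_degree!

theorem monic_cube_add_linear {F : Type*} [Field F] (c a : F) :
    (X ^ 3 + C c * X + C a : F[X]).Monic := by
  monicity!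

theorem irreducible_cube_add_linear {F : Type*} [Field F] {c a : F}
    (h : ∀ t : F, t ^ 3 + c * t + a ≠ 0) : Irreducible (X ^ 3 + C c * X + C a : F[X]) := by
  have hd : (X ^ 3 + C c * X + C a : F[X]).natDegree = 3 := by compute_degree!
  rw [irreducible_iff_roots_eq_zero_of_degree_le_three (by omega) (by omega)]
  refine Multiset.eq_zero_of_forall_notMem fun t ht => h t ?_
  simpa [IsRoot] using isRoot_of_mem_roots ht

/-- A root in the Artin–Schreier extension `F[θ]`, `θ³ - θ = -a`, of `T³ - T + b` with `b ∈ F`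
comes from a root in `F` of `T³ - T + (b - v a)` with `v ∈ 𝔽₃`. -/
theorem exists_root_of_root_adjoinRoot {F : Type*} [Field F] (h3 : (3 : F) = 0) {f : F[X]}
    {a b : F} (hf : f = X ^ 3 + C 2 * X + C a) (hirr : Irreducible f) {t : AdjoinRoot f}
    (ht : t ^ 3 + 2 * t + AdjoinRoot.of f b = 0) :
    ∃ u v : F, v ^ 3 = v ∧ u ^ 3 + 2 * u + (b - v * a) = 0 := by
  have hm : f.Monic := hf ▸ monic_cube_add_linear 2 a
  have hd : f.degree = 3 := hf ▸ degree_cube_add_linear 2 a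
  obtain ⟨g, hg, rfl⟩ := AdjoinRoot.exists_mk_eq_of_degree_lt hm t
  obtain ⟨u, v, w, rfl⟩ : ∃ u v w : F, g = C u + C v * X + C w * X ^ 2 := by
    refine ⟨g.coeff 0, g.coeff 1, g.coeff 2, ?_⟩
    have hn : g.natDegree < 3 := by
      rcases eq_or_ne g 0 with rfl | h0
      · simp
      · exact (natDegree_lt_iff_degree_lt h0).2 (by simpa [hd] using hg)
    conv_lhs => rw [g.as_sum_range_C_mul_X_pow' hn]
    simp [Finset.sum_range_succ]
  have h3' : (3 : F[X]) = 0 := by rw [← C_ofNat, h3, C_0]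
  set r : F[X] := C (u ^ 3 + 2 * u + b - v ^ 3 * a + w ^ 3 * a ^ 2) +
    C (v ^ 3 - v - 2 * a * w ^ 3) * X + C (w ^ 3 - w) * X ^ 2 with hr
  have hr0 : r = 0 := by
    refine AdjoinRoot.eq_zero_of_mk_eq_zero hm (lt_of_le_of_lt (b := 2) ?_ (by rw [hd]; decide)) ?_
    · rw [hr]; compute_degree
    · rw [← AdjoinRoot.mk_C] at ht
      simp only [← map_ofNat (AdjoinRoot.mk f), ← map_pow, ← map_mul, ← map_add] at ht
      rw [← ht, AdjoinRoot.mk_eq_mk]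
      refine ⟨-(C v ^ 3 + C w ^ 3 * (X ^ 3 + X - C a)), ?_⟩
      rw [add_cube h3', add_cube h3', hr, hf]
      simp only [C_add, C_sub, C_mul, C_pow, C_ofNat]
      linear_combination (C v ^ 3 * X - C v * X - C a * C w ^ 3 * X - C w * X ^ 2 +
        C w ^ 3 * X ^ 2 + C w ^ 3 * X ^ 4) * h3'
  have c0 := congrArg (coeff · 0) hr0
  have c1 := congrArg (coeff · 1) hr0
  have c2 := congrArg (coeff · 2) hr0
  simp only [hr, coeff_add, coeff_C_mul, coeff_X_pow, coeff_X, coeff_C, coeff_zero] at c0 c1 c2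
  norm_num at c0 c1 c2
  have hw : w = 0 := by
    by_contra hw
    have hroot : f.IsRoot (v / w) := by
      have hw3 : w ^ 3 = w := sub_eq_zero.1 c2
      have hq : (v / w) ^ 3 = v ^ 3 / w := by rw [div_pow, hw3]
      rw [hf, IsRoot]
      simp only [eval_add, eval_pow, eval_X, eval_mul, eval_C, hq]
      field_simp
      rw [hw3] at c1
      linear_combination c1 + (v + a * w) * h3
    have := degree_eq_one_of_irreducible_of_root hirr hroot
    rw [hd] at this
    exact absurd this (by decide)
  subst hw
  have hv : v ^ 3 = v := by linear_combination c1
  exact ⟨u, v, hv, by linear_combination c0 + a * hv⟩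

/-- The rational part of a root of `T³ - T + (A + B y)` over a quadratic extension `F[y]`,
`y² = -e`, is a root of `T³ - T + A`. -/
theorem exists_root_of_root_quadratic {F : Type*} [Field F] (h3 : (3 : F) = 0) {f : F[X]}
    {e A B : F} (hf : f = X ^ 2 + C e) {t : AdjoinRoot f}
    (ht : t ^ 3 + 2 * t + (AdjoinRoot.of f A + AdjoinRoot.of f B * AdjoinRoot.root f) = 0) :
    ∃ r : F, r ^ 3 + 2 * r + A = 0 := by
  have hm : f.Monic := by rw [hf]; monicity!
  have hd : f.degree = 2 := by rw [hf]; compute_degree!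
  obtain ⟨g, hg, rfl⟩ := AdjoinRoot.exists_mk_eq_of_degree_lt hm t
  obtain ⟨s, r, rfl⟩ := exists_eq_X_add_C_of_natDegree_le_one (p := g) (by
    rcases eq_or_ne g 0 with rfl | h0
    · simp
    · exact Nat.le_of_lt_succ ((natDegree_lt_iff_degree_lt h0).2 (by simpa [hd] using hg)))
  have h3' : (3 : F[X]) = 0 := by rw [← C_ofNat, h3, C_0]
  set k : F[X] := C (2 * s + B - s ^ 3 * e) * X + C (r ^ 3 + 2 * r + A) with hk
  have hk0 : k = 0 := by
    refine AdjoinRoot.eq_zero_of_mk_eq_zero hm (lt_of_le_of_lt (b := 1) ?_ (by rw [hd]; decide)) ?_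
    · rw [hk]; compute_degree
    · rw [← AdjoinRoot.mk_C, ← AdjoinRoot.mk_C, ← AdjoinRoot.mk_X] at ht
      simp only [← map_ofNat (AdjoinRoot.mk f), ← map_pow, ← map_mul, ← map_add] at ht
      rw [← ht, AdjoinRoot.mk_eq_mk]
      refine ⟨-(C s ^ 3 * X), ?_⟩
      rw [add_cube h3', hk, hf]
      simp only [C_add, C_sub, C_mul, C_pow, C_ofNat]
      ring
  have c0 := congrArg (coeff · 0) hk0
  simp only [hk, coeff_add, coeff_C_mul, coeff_X_zero, coeff_C_zero, coeff_zero, mul_zero,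
    zero_add] at c0
  exact ⟨r, c0⟩

/-- `T³ + c T + g/x` with `c` a polynomial has no root in `F(x)` if the polynomial `g` does not vanish
at `0`: a pole of `r` at `0` gives `r³ + c r` a pole of order divisible by `3`. -/
theorem no_root_of_simple_pole_zero {F : Type*} [Field F] {g : F[X]} (hg : ¬ X ∣ g) (c : F[X])
    (r : RatFunc F) :
    r ^ 3 + algebraMap F[X] (RatFunc F) c * r + algebraMap F[X] (RatFunc F) g * RatFunc.X⁻¹ ≠ 0 := by
  intro h
  have hd : algebraMap F[X] (RatFunc F) r.denom ≠ 0 := RatFunc.algebraMap_ne_zero r.denom_ne_zero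
  have hX : (RatFunc.X : RatFunc F) ≠ 0 := RatFunc.X_ne_zero
  have hcop := RatFunc.isCoprime_num_denom r
  rw [← RatFunc.num_div_denom r] at h
  field_simp at h
  rw [← RatFunc.algebraMap_X] at h
  have h' : X * (r.num ^ 3 + c * r.num * r.denom ^ 2) + g * r.denom ^ 3 = 0 := by
    apply RatFunc.algebraMap_injective F
    simp only [map_add, map_mul, map_pow, map_zero]
    linear_combination h
  have hXd : X ∣ r.denom := by
    have : X ∣ g * r.denom ^ 3 := ⟨-(r.num ^ 3 + c * r.num * r.denom ^ 2), by linear_combination h'⟩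
    exact prime_X.dvd_of_dvd_pow ((prime_X.dvd_or_dvd this).resolve_left hg)
  have hXn : X ∣ r.num := by
    obtain ⟨k, hk⟩ := hXd
    rw [hk] at h'
    refine prime_X.dvd_of_dvd_pow (n := 3)
      ⟨-(c * r.num * X * k ^ 2 + g * X * k ^ 3), mul_left_cancel₀ X_ne_zero ?_⟩
    linear_combination h'
  exact not_isUnit_X (hcop.isUnit_of_dvd' hXn hXd)

/-- `T³ + c T + g` with `c` constant has no root in `F(x)` if `g` is a polynomial of
degree `1`: a pole of `r` at infinity gives `r³ + c r` a pole of order divisible by `3`. -/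
theorem no_root_of_degree_one {F : Type*} [Field F] {g : F[X]} (hg : g.natDegree = 1) (c : F)
    (r : RatFunc F) :
    r ^ 3 + RatFunc.C c * r + algebraMap F[X] (RatFunc F) g ≠ 0 := by
  intro h
  have hd : algebraMap F[X] (RatFunc F) r.denom ≠ 0 := RatFunc.algebraMap_ne_zero r.denom_ne_zero
  rw [← RatFunc.num_div_denom r] at h
  field_simp at h
  rw [← RatFunc.algebraMap_C] at h
  have h' : r.num ^ 3 + C c * r.num * r.denom ^ 2 = -(g * r.denom ^ 3) := by
    apply RatFunc.algebraMap_injective F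
    simp only [map_add, map_mul, map_pow, map_neg]
    linear_combination h
  have hR : (-(g * r.denom ^ 3)).natDegree = 1 + 3 * r.denom.natDegree := by
    rw [natDegree_neg, natDegree_mul (by rintro rfl; simp at hg)
      (pow_ne_zero 3 r.denom_ne_zero), natDegree_pow, hg]
  have hL : (C c * r.num * r.denom ^ 2).natDegree ≤ r.num.natDegree + 2 * r.denom.natDegree := by
    refine natDegree_mul_le.trans (add_le_add (natDegree_C_mul_le _ _) ?_)
    rw [natDegree_pow]
  have hN : (r.num ^ 3).natDegree = 3 * r.num.natDegree := natDegree_pow _ _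
  have hT := congrArg natDegree h'
  rw [hR] at hT
  rcases le_or_gt r.num.natDegree r.denom.natDegree with hle | hlt
  · have := natDegree_add_le (r.num ^ 3) (C c * r.num * r.denom ^ 2)
    omega
  · rw [natDegree_add_eq_left_of_natDegree_lt (by omega)] at hT
    omega

/-- Assuming `p` is irreducible (so `K = AdjoinRoot p = F₃(x)(y)` is a field) and the cubic
`q` is irreducible over `K` (so `L = AdjoinRoot q` is a field), the polynomial
`T₂³ + 2T₂ + (x⁴+2x³+x²+2)y/x + (x⁷+2x⁴+2x³+2x+2)/x` is irreducible over `L`. -/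
theorem stmt_11 [Fact (Irreducible p)] [Fact (Irreducible q)] :
    Irreducible (X ^ 3 + C (2 : AdjoinRoot q) * X +
      C (AdjoinRoot.of q
        ((xK ^ 4 + 2 * xK ^ 3 + xK ^ 2 + 2) * y * AdjoinRoot.of p x⁻¹ +
          AdjoinRoot.of p ((x ^ 7 + 2 * x ^ 4 + 2 * x ^ 3 + 2 * x + 2) * x⁻¹))) :
      Polynomial (AdjoinRoot q)) := by
  have h3F : (3 : RatFunc (ZMod 3)) = 0 := by
    rw [← map_ofNat (RatFunc.C (K := ZMod 3)), show (OfNat.ofNat 3 : ZMod 3) = 0 from rfl, map_zero]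
  have h3K : (3 : AdjoinRoot p) = 0 := by rw [← map_ofNat (AdjoinRoot.of p), h3F, map_zero]
  have hx : x ≠ 0 := RatFunc.X_ne_zero
  have key (v : RatFunc (ZMod 3)) (r : RatFunc (ZMod 3)) (hv : v = 0 ∨ v = 1 ∨ v = -1) :
      r ^ 3 + 2 * r + ((x ^ 7 + 2 * x ^ 4 + 2 * x ^ 3 + 2 * x + 2) * x⁻¹ -
        v * (x ^ 6 + 2 * x ^ 2 + 2 * x + x⁻¹)) ≠ 0 := by
    intro h
    rcases hv with rfl | rfl | rfl
    · refine no_root_of_simple_pole_zero (F := ZMod 3)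
        (g := X ^ 7 + 2 * X ^ 4 + 2 * X ^ 3 + 2 * X + 2) ?_ 2 r ?_
      · rw [X_dvd_iff]; simp [coeff_zero_eq_eval_zero]; decide
      · rw [← h]
        simp only [map_add, map_mul, map_pow, map_ofNat, RatFunc.algebraMap_X]
        rw [← x]
        ring
    · refine no_root_of_simple_pole_zero (F := ZMod 3)
        (g := 2 * X ^ 4 - 2 * X ^ 2 + 2 * X + 1) ?_ 2 r ?_
      · rw [X_dvd_iff]; simp [coeff_zero_eq_eval_zero]
      · rw [← h]
        simp only [map_add, map_sub, map_mul, map_pow, map_ofNat, map_one, RatFunc.algebraMap_X]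
        rw [← x]
        field_simp
        ring
    · refine no_root_of_degree_one (F := ZMod 3) (g := X + 2) ?_ 2 (r - x ^ 2 - x) ?_
      · compute_degree!
      · rw [← h, sub_eq_add_neg, add_cube h3F, sub_eq_add_neg, add_cube h3F]
        simp only [map_add, map_ofNat, RatFunc.algebraMap_X]
        rw [← x]
        field_simp
        linear_combination (-x ^ 7 - x ^ 4 - 2 * x ^ 3 - x ^ 2 - 1) * h3F
  refine irreducible_cube_add_linear fun t ht => ?_
  obtain ⟨u, v, hv, hu⟩ := exists_root_of_root_adjoinRoot h3K rfl (Fact.out : Irreducible q) ht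
  obtain ⟨w, rfl, hw⟩ : ∃ w : RatFunc (ZMod 3), AdjoinRoot.of p w = v ∧
      (w = 0 ∨ w = 1 ∨ w = -1) := by
    rcases eq_zero_or_one_or_neg_one_of_cube_eq hv with rfl | rfl | rfl
    · exact ⟨0, map_zero _, by simp⟩
    · exact ⟨1, map_one _, by simp⟩
    · exact ⟨-1, by simp, by simp⟩
  obtain ⟨r, hr⟩ := exists_root_of_root_quadratic (f := p) h3F rfl (t := u)
    (A := (x ^ 7 + 2 * x ^ 4 + 2 * x ^ 3 + 2 * x + 2) * x⁻¹ -
      w * (x ^ 6 + 2 * x ^ 2 + 2 * x + x⁻¹))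
    (B := (x ^ 4 + 2 * x ^ 3 + x ^ 2 + 2) * x⁻¹ - w * (x ^ 3 + 2 * x ^ 2 + x + 1 + x⁻¹)) (by
      refine Eq.trans ?_ hu
      rw [← y]
      simp only [map_add, map_sub, map_mul, map_pow, map_ofNat, map_one]
      rw [← xK]
      ring)
  exact key w r hw hr
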